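/- Fix real numbers α, β with 0 < α < 1 and 0 < β < 1. Let M₁, M₂ ≥ 2, H ≥ 1 be real numbers, Δ > 0 a real number, and μ ≥ 1 an integer. Let 𝓑(M₁,M₂,H,Δ,μ) be the number of six-tuples (m₁, m̃₁, m₂, m̃₂, h, h̃) of positive integers with m₁, m̃₁ ~ M₁, m₂, m̃₂ ~ M₂, h, h̃ ~ H, m₁ ≠ m₂, m̃₁ ≠ m̃₂, gcd(h, h̃) = μ, and |(m₁^α − m₂^α) h^β − (m̃₁^α − m̃₂^α) h̃^β| ≤ Δ. Then 𝓑(M₁,M₂,H,Δ,μ) ≪ M₁² M₂² + Δ (M₁M₂)^{2−α/2} H^{2−β} μ^{−2} (log M₁)(log M₂), where the implied constant depends only on α, β. -/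

import Mathlib

open Real Finset

/-- `𝓑(M₁,M₂,H,Δ,μ)`: the number of six-tuples `(m₁, m̃₁, m₂, m̃₂, h, h̃)` of positive
integers with `m₁, m̃₁ ~ M₁`, `m₂, m̃₂ ~ M₂`, `h, h̃ ~ H`, `m₁ ≠ m₂`, `m̃₁ ≠ m̃₂`,
`gcd(h, h̃) = μ` and `|(m₁^α − m₂^α) h^β − (m̃₁^α − m̃₂^α) h̃^β| ≤ Δ`. -/
noncomputable def BcountGcd (α β M₁ M₂ H Δ : ℝ) (μ : ℕ) : ℕ :=
  ((Finset.Ioc ⌊M₁⌋₊ ⌊2*M₁⌋₊ ×ˢ Finset.Ioc ⌊M₁⌋₊ ⌊2*M₁⌋₊ ×ˢ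
    Finset.Ioc ⌊M₂⌋₊ ⌊2*M₂⌋₊ ×ˢ Finset.Ioc ⌊M₂⌋₊ ⌊2*M₂⌋₊ ×ˢ
    Finset.Ioc ⌊H⌋₊ ⌊2*H⌋₊ ×ˢ Finset.Ioc ⌊H⌋₊ ⌊2*H⌋₊).filter
      (fun t : ℕ × ℕ × ℕ × ℕ × ℕ × ℕ =>
        t.1 ≠ t.2.2.1 ∧ t.2.1 ≠ t.2.2.2.1 ∧
        Nat.gcd t.2.2.2.2.1 t.2.2.2.2.2 = μ ∧
        |((t.1 : ℝ)^α - (t.2.2.1 : ℝ)^α) * (t.2.2.2.2.1 : ℝ)^β -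
          ((t.2.1 : ℝ)^α - (t.2.2.2.1 : ℝ)^α) * (t.2.2.2.2.2 : ℝ)^β| ≤ Δ)).card

/-- Concavity lower bound for differences of powers with exponent in `(0,1)`, ordered form. -/
lemma mul_sub_le_rpow_sub_rpow {γ u v T : ℝ} (hγ0 : 0 < γ) (hγ1 : γ < 1)
    (hv : 0 < v) (hvu : v ≤ u) (huT : u ≤ T) :
    γ * T ^ (γ - 1) * (u - v) ≤ u ^ γ - v ^ γ := by
  have hu : 0 < u := hv.trans_le hvu
  have hbern : (v / u) ^ γ ≤ 1 + γ * (v / u - 1) := by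
    have := rpow_one_add_le_one_add_mul_self (s := v / u - 1)
      (by linarith [div_pos hv hu]) hγ0.le hγ1.le
    simpa using this
  rw [Real.div_rpow hv.le hu.le, div_le_iff₀ (Real.rpow_pos_of_pos hu γ)] at hbern
  have hpow : u ^ γ = u ^ (γ - 1) * u := by
    rw [Real.rpow_sub_one hu.ne']; field_simp
  have hlin : γ * u ^ (γ - 1) * (u - v) ≤ u ^ γ - v ^ γ := by
    have : (1 + γ * (v / u - 1)) * u ^ γ = u ^ γ - γ * u ^ (γ - 1) * (u - v) := by
      rw [hpow]; field_simp; ring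
    linarith
  have hT : T ^ (γ - 1) ≤ u ^ (γ - 1) :=
    Real.rpow_le_rpow_of_nonpos hu huT (by linarith)
  calc γ * T ^ (γ - 1) * (u - v) ≤ γ * u ^ (γ - 1) * (u - v) := by
        have := sub_nonneg.2 hvu
        gcongr
    _ ≤ _ := hlin

/-- Concavity lower bound for differences of powers with exponent in `(0,1)`. -/
lemma mul_abs_sub_le_abs_rpow_sub_rpow {γ u v T : ℝ} (hγ0 : 0 < γ) (hγ1 : γ < 1)
    (hu : 0 < u) (hv : 0 < v) (huT : u ≤ T) (hvT : v ≤ T) :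
    γ * T ^ (γ - 1) * |u - v| ≤ |u ^ γ - v ^ γ| := by
  rcases le_total v u with h | h
  · rw [abs_of_nonneg (sub_nonneg.2 h)]
    exact (mul_sub_le_rpow_sub_rpow hγ0 hγ1 hv h huT).trans (le_abs_self _)
  · rw [abs_sub_comm u v, abs_sub_comm (u ^ γ), abs_of_nonneg (sub_nonneg.2 h)]
    exact (mul_sub_le_rpow_sub_rpow hγ0 hγ1 hu h hvT).trans (le_abs_self _)

/-- A `δ`-separated family of real numbers of diameter at most `L` has at most `1 + L / δ`
members. -/
lemma card_le_one_add_div_of_separated {ι : Type*} (s : Finset ι) (f : ι → ℝ) {δ L : ℝ}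
    (hδ : 0 < δ) (hL : 0 ≤ L) (hsep : ∀ i ∈ s, ∀ j ∈ s, i ≠ j → δ ≤ |f i - f j|)
    (hdiam : ∀ i ∈ s, ∀ j ∈ s, |f i - f j| ≤ L) : (s.card : ℝ) ≤ 1 + L / δ := by
  rcases s.eq_empty_or_nonempty with rfl | hs
  · simp only [Finset.card_empty, Nat.cast_zero]; positivity
  obtain ⟨i₀, hi₀, hmin⟩ := s.exists_min_image f hs
  have hcard : s.card ≤ (Finset.range (⌊L / δ⌋₊ + 1)).card := by
    refine Finset.card_le_card_of_injOn (fun i => ⌊(f i - f i₀) / δ⌋₊) ?_ ?_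
    · intro i hi
      simp only [Finset.coe_range, Set.mem_Iio, Nat.lt_succ_iff]
      exact Nat.floor_le_floor (div_le_div_of_nonneg_right
        ((le_abs_self _).trans (hdiam i hi i₀ hi₀)) hδ.le)
    · intro i hi j hj hij
      by_contra hne
      have hgap := hsep i hi j hj hne
      have hi' : 0 ≤ (f i - f i₀) / δ := div_nonneg (sub_nonneg.2 (hmin i hi)) hδ.le
      have hj' : 0 ≤ (f j - f i₀) / δ := div_nonneg (sub_nonneg.2 (hmin j hj)) hδ.le
      have h1 := Nat.floor_le hi'
      have h2 := Nat.lt_floor_add_one ((f i - f i₀) / δ)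
      have h3 := Nat.floor_le hj'
      have h4 := Nat.lt_floor_add_one ((f j - f i₀) / δ)
      simp only at hij
      rw [hij] at h1 h2
      have h5 : |(f i - f i₀) / δ - (f j - f i₀) / δ| < 1 :=
        abs_lt.2 ⟨by linarith, by linarith⟩
      rw [← sub_div, abs_div, abs_of_pos hδ, div_lt_one hδ, sub_sub_sub_cancel_right] at h5
      linarith
  rw [Finset.card_range] at hcard
  calc (s.card : ℝ) ≤ ((⌊L / δ⌋₊ + 1 : ℕ) : ℝ) := by exact_mod_cast hcard
    _ ≤ 1 + L / δ := by
      push_cast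
      linarith [Nat.floor_le (div_nonneg hL hδ.le)]

/-- Distinct pairs with the same gcd `μ` have cross determinant at least `μ ^ 2`. -/
lemma sq_gcd_le_abs_cross {a b c d μ : ℕ} (hab : Nat.gcd a b = μ)
    (hcd : Nat.gcd c d = μ) (hne : (a, b) ≠ (c, d)) :
    (μ : ℝ) ^ 2 ≤ |(a : ℝ) * d - c * b| := by
  obtain ⟨a', b', hab', ha, hb⟩ := Nat.exists_coprime a b
  obtain ⟨c', d', hcd', hc, hd⟩ := Nat.exists_coprime c d
  rw [hab] at ha hb
  rw [hcd] at hc hd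
  clear hab hcd
  subst ha hb hc hd
  have hdet : (a' : ℤ) * d' - c' * b' ≠ 0 := by
    intro h
    have h' : a' * d' = c' * b' := by
      have := sub_eq_zero.1 h
      exact_mod_cast this
    apply hne
    have hac : a' = c' := Nat.dvd_antisymm (hab'.dvd_of_dvd_mul_right (Dvd.intro _ h'))
      (hcd'.dvd_of_dvd_mul_right (Dvd.intro _ h'.symm))
    have hbd : b' = d' := Nat.dvd_antisymm
      (hab'.symm.dvd_of_dvd_mul_left (Dvd.intro_left _ h'.symm))
      (hcd'.symm.dvd_of_dvd_mul_left (Dvd.intro_left _ h'))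
    rw [hac, hbd]
  have hone : (1 : ℝ) ≤ |(a' : ℝ) * d' - c' * b'| := by
    exact_mod_cast Int.one_le_abs hdet
  have hfac : ((a' * μ : ℕ) : ℝ) * ((d' * μ : ℕ) : ℝ) - ((c' * μ : ℕ) : ℝ) * ((b' * μ : ℕ) : ℝ)
      = (μ : ℝ) ^ 2 * ((a' : ℝ) * d' - c' * b') := by push_cast; ring
  rw [hfac, abs_mul, abs_of_nonneg (by positivity)]
  nlinarith [sq_nonneg (μ : ℝ)]

lemma bounds_of_mem_Ioc_floor {M : ℝ} (hM : 0 ≤ M) {m : ℕ}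
    (hm : m ∈ Finset.Ioc ⌊M⌋₊ ⌊2 * M⌋₊) : M < m ∧ (m : ℝ) ≤ 2 * M := by
  rw [Finset.mem_Ioc] at hm
  exact ⟨(Nat.floor_lt hM).1 hm.1, (Nat.le_floor_iff (by positivity)).1 hm.2⟩

lemma card_Ioc_floor_le {M : ℝ} (hM : 0 ≤ M) :
    ((Finset.Ioc ⌊M⌋₊ ⌊2 * M⌋₊).card : ℝ) ≤ 2 * M := by
  rw [Nat.card_Ioc]
  calc ((⌊2 * M⌋₊ - ⌊M⌋₊ : ℕ) : ℝ) ≤ (⌊2 * M⌋₊ : ℝ) := by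
        exact_mod_cast Nat.sub_le _ _
    _ ≤ 2 * M := Nat.floor_le (by positivity)

/-- For a fixed nonzero coefficient `x`, the number of dyadic pairs `(h, k)` of gcd `μ` with
`x h ^ β` within `Δ` of `y k ^ β`. -/
lemma card_pairs_le {β H Δ x : ℝ} (hβ0 : 0 < β) (hβ1 : β < 1) (hH : 1 ≤ H) (hΔ : 0 < Δ)
    (hx : x ≠ 0) (y : ℝ) {μ : ℕ} (hμ : 1 ≤ μ) :
    (((Finset.Ioc ⌊H⌋₊ ⌊2 * H⌋₊ ×ˢ Finset.Ioc ⌊H⌋₊ ⌊2 * H⌋₊).filter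
      (fun p : ℕ × ℕ => Nat.gcd p.1 p.2 = μ ∧
        |x * (p.1 : ℝ) ^ β - y * (p.2 : ℝ) ^ β| ≤ Δ)).card : ℝ)
      ≤ 1 + 16 / β * Δ * H ^ (2 - β) * ((μ : ℝ) ^ 2)⁻¹ * |x|⁻¹ := by
  have hH0 : 0 < H := by linarith
  have hx0 : 0 < |x| := abs_pos.2 hx
  have hμ0 : (0 : ℝ) < μ := by exact_mod_cast hμ
  have hHβ : 0 < H ^ β := Real.rpow_pos_of_pos hH0 β
  have hrhs : 16 / β * Δ * H ^ (2 - β) * ((μ : ℝ) ^ 2)⁻¹ * |x|⁻¹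
      = (4 * Δ / (β * |x| * H ^ β)) / ((μ : ℝ) ^ 2 / (4 * H ^ 2)) := by
    rw [Real.rpow_sub hH0, Real.rpow_two]
    field_simp
    norm_num
  rw [hrhs]
  refine card_le_one_add_div_of_separated _ (fun p : ℕ × ℕ => (p.1 : ℝ) / p.2)
    (by positivity) (by positivity) ?_ ?_
  · rintro ⟨a, b⟩ hp ⟨c, d⟩ hq hne
    simp only [Finset.mem_filter, Finset.mem_product] at hp hq ⊢
    obtain ⟨⟨-, hb⟩, hab, -⟩ := hp
    obtain ⟨⟨-, hd⟩, hcd, -⟩ := hq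
    obtain ⟨hb1, hb2⟩ := bounds_of_mem_Ioc_floor hH0.le hb
    obtain ⟨hd1, hd2⟩ := bounds_of_mem_Ioc_floor hH0.le hd
    have hb0 : (0 : ℝ) < b := hH0.trans hb1
    have hd0 : (0 : ℝ) < d := hH0.trans hd1
    rw [div_sub_div _ _ hb0.ne' hd0.ne', abs_div, abs_of_pos (mul_pos hb0 hd0)]
    have hcross := sq_gcd_le_abs_cross hab hcd hne
    rw [mul_comm (c : ℝ)] at hcross
    refine div_le_div₀ (abs_nonneg _) hcross (by positivity) ?_
    nlinarith
  · have key : ∀ p : ℕ × ℕ, p ∈ ((Finset.Ioc ⌊H⌋₊ ⌊2 * H⌋₊ ×ˢ Finset.Ioc ⌊H⌋₊ ⌊2 * H⌋₊).filter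
        (fun p : ℕ × ℕ => Nat.gcd p.1 p.2 = μ ∧
          |x * (p.1 : ℝ) ^ β - y * (p.2 : ℝ) ^ β| ≤ Δ)) →
        0 < (p.1 : ℝ) / p.2 ∧ (p.1 : ℝ) / p.2 ≤ 2 ∧
        |((p.1 : ℝ) / p.2) ^ β - y / x| ≤ Δ / (|x| * H ^ β) := by
      rintro ⟨a, b⟩ hp
      simp only [Finset.mem_filter, Finset.mem_product] at hp ⊢
      obtain ⟨⟨ha, hb⟩, -, hab⟩ := hp
      obtain ⟨ha1, ha2⟩ := bounds_of_mem_Ioc_floor hH0.le ha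
      obtain ⟨hb1, hb2⟩ := bounds_of_mem_Ioc_floor hH0.le hb
      have ha0 : (0 : ℝ) < a := hH0.trans ha1
      have hb0 : (0 : ℝ) < b := hH0.trans hb1
      have hbβ : 0 < (b : ℝ) ^ β := Real.rpow_pos_of_pos hb0 β
      refine ⟨by positivity, (div_le_iff₀ hb0).2 (by linarith), ?_⟩
      have heq : ((a : ℝ) / b) ^ β - y / x
          = (x * (a : ℝ) ^ β - y * (b : ℝ) ^ β) / (x * (b : ℝ) ^ β) := by
        rw [Real.div_rpow ha0.le hb0.le]
        field_simp
      rw [heq, abs_div, abs_mul, abs_of_pos hbβ]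
      have : H ^ β ≤ (b : ℝ) ^ β := Real.rpow_le_rpow hH0.le hb1.le hβ0.le
      gcongr
    intro p hp q hq
    obtain ⟨hp0, hp2, hp⟩ := key p hp
    obtain ⟨hq0, hq2, hq⟩ := key q hq
    have hlow := mul_abs_sub_le_abs_rpow_sub_rpow hβ0 hβ1 hp0 hq0 hp2 hq2
    have hup : |((p.1 : ℝ) / p.2) ^ β - ((q.1 : ℝ) / q.2) ^ β| ≤ 2 * (Δ / (|x| * H ^ β)) := by
      have := abs_sub_le (((p.1 : ℝ) / p.2) ^ β) (y / x) (((q.1 : ℝ) / q.2) ^ β)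
      rw [abs_sub_comm (y / x)] at this
      linarith
    have htwo : (1 / 2 : ℝ) ≤ 2 ^ (β - 1) := by
      calc (1 / 2 : ℝ) = 2 ^ (-1 : ℝ) := by rw [Real.rpow_neg_one]; norm_num
        _ ≤ 2 ^ (β - 1) := Real.rpow_le_rpow_of_exponent_le (by norm_num) (by linarith)
    have hhalf : β * (1 / 2) * |(p.1 : ℝ) / p.2 - (q.1 : ℝ) / q.2| ≤ 2 * (Δ / (|x| * H ^ β)) :=
      calc β * (1 / 2) * |(p.1 : ℝ) / p.2 - (q.1 : ℝ) / q.2|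
          ≤ β * 2 ^ (β - 1) * |(p.1 : ℝ) / p.2 - (q.1 : ℝ) / q.2| := by gcongr
        _ ≤ _ := hlow.trans hup
    have hfin : 4 * Δ / (β * |x| * H ^ β) = 2 * (Δ / (|x| * H ^ β)) / (β * (1 / 2)) := by
      field_simp
      norm_num
    rw [hfin, le_div_iff₀ (by positivity)]
    linarith

/-- The sum of the reciprocals of the nonzero distances from `a` to the integers up to `N`. -/
lemma sum_inv_abs_sub_le {a N : ℕ} (haN : a ≤ N) :
    ∑ b ∈ Finset.range (N + 1), |(a : ℝ) - b|⁻¹ ≤ 2 * (1 + Real.log N) := by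
  have hharm : ∀ n ≤ N, ∑ i ∈ Finset.range n, ((i : ℝ) + 1)⁻¹ ≤ 1 + Real.log N := by
    intro n hn
    calc ∑ i ∈ Finset.range n, ((i : ℝ) + 1)⁻¹
        ≤ ∑ i ∈ Finset.range N, ((i : ℝ) + 1)⁻¹ :=
          Finset.sum_le_sum_of_subset_of_nonneg (Finset.range_subset_range.2 hn)
            (fun i _ _ => by positivity)
      _ = (harmonic N : ℝ) := by simp [harmonic]
      _ ≤ 1 + Real.log N := harmonic_le_one_add_log N
  have hleft : ∑ b ∈ Finset.range a, |(a : ℝ) - b|⁻¹ ≤ 1 + Real.log N := by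
    rw [← Finset.sum_range_reflect]
    refine le_trans (le_of_eq (Finset.sum_congr rfl fun j hj => ?_)) (hharm a haN)
    rw [Finset.mem_range] at hj
    rw [Nat.sub_sub, Nat.cast_sub (by omega), sub_sub_cancel]
    push_cast
    rw [abs_of_pos (by positivity), add_comm]
  have hright : ∑ b ∈ Finset.Ico a (N + 1), |(a : ℝ) - b|⁻¹ ≤ 1 + Real.log N := by
    rw [Finset.sum_Ico_eq_sum_range, Nat.sub_add_comm haN, Finset.sum_range_succ']
    refine le_trans (le_of_eq ?_) (hharm (N - a) (Nat.sub_le _ _))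
    simp only [Nat.cast_add, add_zero, sub_self, abs_zero, inv_zero, Nat.cast_one]
    refine Finset.sum_congr rfl fun j _ => ?_
    rw [sub_add_cancel_left, abs_neg, abs_of_pos (by positivity)]
  rw [← Finset.sum_range_add_sum_Ico _ (Nat.le_succ_of_le haN)]
  linarith

lemma sum_inv_abs_rpow_sub_rpow_le_of_le {α M₁ M₂ : ℝ} (hα0 : 0 < α) (hα1 : α < 1)
    (h₁ : 2 ≤ M₁) (h₁₂ : M₁ ≤ M₂) :
    ∑ a ∈ Finset.Ioc ⌊M₁⌋₊ ⌊2 * M₁⌋₊, ∑ b ∈ Finset.Ioc ⌊M₂⌋₊ ⌊2 * M₂⌋₊,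
        |(a : ℝ) ^ α - (b : ℝ) ^ α|⁻¹
      ≤ 64 / α * (M₁ * M₂) ^ (1 - α / 2) * Real.log M₁ * Real.log M₂ := by
  have hM₁ : 0 < M₁ := by linarith
  have hM₂ : 0 < M₂ := by linarith
  have hlog2 : (1 / 2 : ℝ) < Real.log 2 := by linarith [Real.log_two_gt_d9]
  have hl₁ : 1 / 2 ≤ Real.log M₁ := hlog2.le.trans (Real.log_le_log (by norm_num) h₁)
  have hl₂ : Real.log 2 ≤ Real.log M₂ := Real.log_le_log (by norm_num) (by linarith)
  have hinner : ∀ a ∈ Finset.Ioc ⌊M₁⌋₊ ⌊2 * M₁⌋₊, ∑ b ∈ Finset.Ioc ⌊M₂⌋₊ ⌊2 * M₂⌋₊,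
      |(a : ℝ) ^ α - (b : ℝ) ^ α|⁻¹ ≤ 2 / α * M₂ ^ (1 - α) * (8 * Real.log M₂) := by
    intro a ha
    obtain ⟨ha1, ha2⟩ := bounds_of_mem_Ioc_floor hM₁.le ha
    have ha0 : (0 : ℝ) < a := hM₁.trans ha1
    have haN : a ≤ ⌊2 * M₂⌋₊ := Nat.le_floor (by linarith)
    have hN : Real.log (⌊2 * M₂⌋₊ : ℝ) ≤ Real.log 2 + Real.log M₂ := by
      rw [← Real.log_mul (by norm_num) hM₂.ne']
      refine Real.log_le_log ?_ (Nat.floor_le (by positivity))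
      exact ha0.trans_le (by exact_mod_cast haN)
    have hterm : ∀ b ∈ Finset.Ioc ⌊M₂⌋₊ ⌊2 * M₂⌋₊, |(a : ℝ) ^ α - (b : ℝ) ^ α|⁻¹
        ≤ 2 / α * M₂ ^ (1 - α) * |(a : ℝ) - b|⁻¹ := by
      intro b hb
      obtain ⟨hb1, hb2⟩ := bounds_of_mem_Ioc_floor hM₂.le hb
      rcases eq_or_ne (a : ℝ) b with hab | hab
      · simp [hab]
      have hd : 0 < |(a : ℝ) - b| := abs_pos.2 (sub_ne_zero.2 hab)
      have hlow := mul_abs_sub_le_abs_rpow_sub_rpow (T := 2 * M₂) hα0 hα1 ha0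
        (hM₂.trans hb1) (by linarith) hb2
      have hT : 0 < (2 * M₂) ^ (α - 1) := by positivity
      calc |(a : ℝ) ^ α - (b : ℝ) ^ α|⁻¹
          ≤ (α * (2 * M₂) ^ (α - 1) * |(a : ℝ) - b|)⁻¹ := by gcongr
        _ = 1 / α * (2 * M₂) ^ (1 - α) * |(a : ℝ) - b|⁻¹ := by
            rw [mul_inv, mul_inv, ← Real.rpow_neg (by positivity), neg_sub, one_div]
        _ ≤ 1 / α * (2 * M₂ ^ (1 - α)) * |(a : ℝ) - b|⁻¹ := by
            rw [Real.mul_rpow (by norm_num) hM₂.le]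
            have : (2 : ℝ) ^ (1 - α) ≤ 2 := by
              simpa using Real.rpow_le_rpow_of_exponent_le (x := 2) (by norm_num)
                (show 1 - α ≤ 1 by linarith)
            gcongr
        _ = _ := by ring
    have hsub : Finset.Ioc ⌊M₂⌋₊ ⌊2 * M₂⌋₊ ⊆ Finset.range (⌊2 * M₂⌋₊ + 1) := by
      intro b hb
      rw [Finset.mem_Ioc] at hb
      exact Finset.mem_range.2 (Nat.lt_succ_of_le hb.2)
    calc ∑ b ∈ Finset.Ioc ⌊M₂⌋₊ ⌊2 * M₂⌋₊, |(a : ℝ) ^ α - (b : ℝ) ^ α|⁻¹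
        ≤ ∑ b ∈ Finset.Ioc ⌊M₂⌋₊ ⌊2 * M₂⌋₊, 2 / α * M₂ ^ (1 - α) * |(a : ℝ) - b|⁻¹ :=
          Finset.sum_le_sum hterm
      _ = 2 / α * M₂ ^ (1 - α) * ∑ b ∈ Finset.Ioc ⌊M₂⌋₊ ⌊2 * M₂⌋₊, |(a : ℝ) - b|⁻¹ := by
          rw [Finset.mul_sum]
      _ ≤ 2 / α * M₂ ^ (1 - α) * (8 * Real.log M₂) := by
          have hle := (Finset.sum_le_sum_of_subset_of_nonneg hsub
            (fun b _ _ => inv_nonneg.2 (abs_nonneg ((a : ℝ) - b)))).trans (sum_inv_abs_sub_le haN)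
          gcongr
          linarith
  have hpow : M₁ * M₂ ^ (1 - α) ≤ (M₁ * M₂) ^ (1 - α / 2) := by
    have hsplit₁ : M₁ = M₁ ^ (1 - α / 2) * M₁ ^ (α / 2) := by
      rw [← Real.rpow_add hM₁]; simp
    have hsplit₂ : M₂ ^ (1 - α / 2) = M₂ ^ (1 - α) * M₂ ^ (α / 2) := by
      rw [← Real.rpow_add hM₂]; ring_nf
    have hmono : M₁ ^ (α / 2) ≤ M₂ ^ (α / 2) := by gcongr
    rw [Real.mul_rpow hM₁.le hM₂.le, hsplit₂]
    calc M₁ * M₂ ^ (1 - α) = M₁ ^ (1 - α / 2) * M₁ ^ (α / 2) * M₂ ^ (1 - α) := by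
          rw [← hsplit₁]
      _ ≤ M₁ ^ (1 - α / 2) * M₂ ^ (α / 2) * M₂ ^ (1 - α) := by gcongr
      _ = _ := by ring
  have hl₂0 : 0 < Real.log M₂ := by linarith
  calc ∑ a ∈ Finset.Ioc ⌊M₁⌋₊ ⌊2 * M₁⌋₊, ∑ b ∈ Finset.Ioc ⌊M₂⌋₊ ⌊2 * M₂⌋₊,
        |(a : ℝ) ^ α - (b : ℝ) ^ α|⁻¹
      ≤ ∑ _a ∈ Finset.Ioc ⌊M₁⌋₊ ⌊2 * M₁⌋₊, 2 / α * M₂ ^ (1 - α) * (8 * Real.log M₂) :=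
        Finset.sum_le_sum hinner
    _ = ((Finset.Ioc ⌊M₁⌋₊ ⌊2 * M₁⌋₊).card : ℝ) *
          (2 / α * M₂ ^ (1 - α) * (8 * Real.log M₂)) := by
        rw [Finset.sum_const, nsmul_eq_mul]
    _ ≤ (2 * M₁) * (2 / α * M₂ ^ (1 - α) * (8 * Real.log M₂)) := by
        have := card_Ioc_floor_le hM₁.le
        gcongr
    _ = 64 / α * (M₁ * M₂ ^ (1 - α)) * (1 / 2) * Real.log M₂ := by ring
    _ ≤ 64 / α * (M₁ * M₂) ^ (1 - α / 2) * Real.log M₁ * Real.log M₂ := by gcongr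

lemma sum_inv_abs_rpow_sub_rpow_le {α M₁ M₂ : ℝ} (hα0 : 0 < α) (hα1 : α < 1)
    (h₁ : 2 ≤ M₁) (h₂ : 2 ≤ M₂) :
    ∑ a ∈ Finset.Ioc ⌊M₁⌋₊ ⌊2 * M₁⌋₊, ∑ b ∈ Finset.Ioc ⌊M₂⌋₊ ⌊2 * M₂⌋₊,
        |(a : ℝ) ^ α - (b : ℝ) ^ α|⁻¹
      ≤ 64 / α * (M₁ * M₂) ^ (1 - α / 2) * Real.log M₁ * Real.log M₂ := by
  rcases le_total M₁ M₂ with h | h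
  · exact sum_inv_abs_rpow_sub_rpow_le_of_le hα0 hα1 h₁ h
  · rw [Finset.sum_comm, mul_comm M₁, mul_right_comm]
    refine le_trans (le_of_eq ?_) (sum_inv_abs_rpow_sub_rpow_le_of_le hα0 hα1 h₂ h)
    exact Finset.sum_congr rfl fun b _ => Finset.sum_congr rfl fun a _ => by
      rw [abs_sub_comm]

lemma BcountGcd_le_sum {α β M₁ M₂ H Δ : ℝ} {μ : ℕ} (hα0 : 0 < α)
    (hβ0 : 0 < β) (hβ1 : β < 1) (hH : 1 ≤ H) (hΔ : 0 < Δ) (hμ : 1 ≤ μ) :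
    (BcountGcd α β M₁ M₂ H Δ μ : ℝ) ≤
      ∑ a ∈ Finset.Ioc ⌊M₁⌋₊ ⌊2 * M₁⌋₊, ∑ _a' ∈ Finset.Ioc ⌊M₁⌋₊ ⌊2 * M₁⌋₊,
      ∑ b ∈ Finset.Ioc ⌊M₂⌋₊ ⌊2 * M₂⌋₊, ∑ _b' ∈ Finset.Ioc ⌊M₂⌋₊ ⌊2 * M₂⌋₊,
        (1 + 16 / β * Δ * H ^ (2 - β) * ((μ : ℝ) ^ 2)⁻¹ * |(a : ℝ) ^ α - (b : ℝ) ^ α|⁻¹) := by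
  rw [BcountGcd, Finset.card_filter]
  push_cast
  simp only [Finset.sum_product]
  refine Finset.sum_le_sum fun a _ => Finset.sum_le_sum fun a' _ =>
    Finset.sum_le_sum fun b _ => Finset.sum_le_sum fun b' _ => ?_
  rcases eq_or_ne a b with hab | hab
  · subst hab
    simp
  have hx : (a : ℝ) ^ α - (b : ℝ) ^ α ≠ 0 := by
    intro h
    apply hab
    exact_mod_cast (Real.rpow_left_inj (Nat.cast_nonneg a) (Nat.cast_nonneg b) hα0.ne').1
      (sub_eq_zero.1 h)
  refine le_trans ?_ (card_pairs_le hβ0 hβ1 hH hΔ hx ((a' : ℝ) ^ α - (b' : ℝ) ^ α) hμ)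
  rw [Finset.card_filter]
  push_cast
  rw [Finset.sum_product]
  refine Finset.sum_le_sum fun h _ => Finset.sum_le_sum fun h' _ => ?_
  split_ifs with h1 h2
  · exact le_rfl
  · exact absurd h1.2.2 h2
  · norm_num
  · exact le_rfl

theorem spacing_count_fixed_gcd (α β : ℝ)
    (hα0 : 0 < α) (hα1 : α < 1) (hβ0 : 0 < β) (hβ1 : β < 1) :
    ∃ C : ℝ, 0 < C ∧ ∀ (M₁ M₂ H Δ : ℝ) (μ : ℕ),
      2 ≤ M₁ → 2 ≤ M₂ → 1 ≤ H → 0 < Δ → 1 ≤ μ →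
      (BcountGcd α β M₁ M₂ H Δ μ : ℝ)
        ≤ C * (M₁^2 * M₂^2
          + Δ * (M₁*M₂)^(2 - α/2) * H^(2 - β) * ((μ : ℝ)^2)⁻¹
              * Real.log M₁ * Real.log M₂) := by
  refine ⟨16 + 4096 / (α * β), by positivity, ?_⟩
  intro M₁ M₂ H Δ μ h₁ h₂ hH hΔ hμ
  have hM₁ : 0 < M₁ := by linarith
  have hM₂ : 0 < M₂ := by linarith
  have hH0 : 0 < H := by linarith
  have hl₁ : 0 < Real.log M₁ := Real.log_pos (by linarith)
  have hl₂ : 0 < Real.log M₂ := Real.log_pos (by linarith)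
  have hc₁ := card_Ioc_floor_le hM₁.le
  have hc₂ := card_Ioc_floor_le hM₂.le
  have hsum := sum_inv_abs_rpow_sub_rpow_le hα0 hα1 h₁ h₂
  have hpow : (M₁ * M₂) ^ (2 - α / 2) = M₁ * M₂ * (M₁ * M₂) ^ (1 - α / 2) := by
    rw [← Real.rpow_one_add' (by positivity) (by linarith)]
    ring_nf
  refine (BcountGcd_le_sum hα0 hβ0 hβ1 hH hΔ hμ).trans ?_
  simp only [Finset.sum_const, nsmul_eq_mul, ← Finset.mul_sum, Finset.sum_add_distrib, mul_one]
  set K : ℝ := 16 / β * Δ * H ^ (2 - β) * ((μ : ℝ) ^ 2)⁻¹ with hK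
  set S : ℝ := ∑ a ∈ Finset.Ioc ⌊M₁⌋₊ ⌊2 * M₁⌋₊, ∑ b ∈ Finset.Ioc ⌊M₂⌋₊ ⌊2 * M₂⌋₊,
    |(a : ℝ) ^ α - (b : ℝ) ^ α|⁻¹
  set c₁ : ℝ := ((Finset.Ioc ⌊M₁⌋₊ ⌊2 * M₁⌋₊).card : ℝ)
  set c₂ : ℝ := ((Finset.Ioc ⌊M₂⌋₊ ⌊2 * M₂⌋₊).card : ℝ)
  have hK0 : 0 ≤ K := by positivity
  have hS0 : 0 ≤ S :=
    Finset.sum_nonneg fun a _ => Finset.sum_nonneg fun b _ => inv_nonneg.2 (abs_nonneg _)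
  have hc₁0 : 0 ≤ c₁ := Nat.cast_nonneg _
  have hc₂0 : 0 ≤ c₂ := Nat.cast_nonneg _
  set E : ℝ := Δ * (M₁ * M₂) ^ (2 - α / 2) * H ^ (2 - β) * ((μ : ℝ) ^ 2)⁻¹
    * Real.log M₁ * Real.log M₂ with hE
  have hE0 : 0 ≤ E := by positivity
  calc _ = c₁ * c₁ * (c₂ * c₂) + c₁ * c₂ * (K * S) := by ring
    _ ≤ (2 * M₁) * (2 * M₁) * ((2 * M₂) * (2 * M₂)) + (2 * M₁) * (2 * M₂) *
        (K * (64 / α * (M₁ * M₂) ^ (1 - α / 2) * Real.log M₁ * Real.log M₂)) := by gcongr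
    _ = 16 * (M₁ ^ 2 * M₂ ^ 2) + 4096 / (α * β) * E := by
        rw [hE, hK, hpow]
        field_simp
        ring
    _ ≤ (16 + 4096 / (α * β)) * (M₁ ^ 2 * M₂ ^ 2 + E) := by
        have h3 : 0 ≤ 4096 / (α * β) * (M₁ ^ 2 * M₂ ^ 2) := by positivity
        linarith
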